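/- arXiv:0801.2083 — 5 statements merged into one kernel-verified Lean document; each statement's English description precedes it below -/
import Mathlib

section
/- Let ψ : ℝ → ℝ be nonnegative and β > 0. Then the function x ↦ 1/(1 + β·log(1 + ψ(x))) is a distribution function if and only if the function x ↦ (1 + ψ(x))^(−β) is a distribution function (Theorem 2.2). -/
open Filter

/-- A function `F : ℝ → ℝ` is a distribution function if it is monotone
nondecreasing, right-continuous everywhere, tends to 0 at -∞ and to 1 at +∞. -/
def IsDistributionFunction (F : ℝ → ℝ) : Prop :=
  Monotone F ∧ (∀ x : ℝ, ContinuousWithinAt F (Set.Ici x) x) ∧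
    Tendsto F atBot (nhds 0) ∧ Tendsto F atTop (nhds 1)

theorem isDistributionFunction_one_div_one_add_iff (L : ℝ → ℝ) (hL : ∀ x, 0 ≤ L x) :
    IsDistributionFunction (fun x => 1 / (1 + L x)) ↔
      Antitone L ∧ (∀ x : ℝ, ContinuousWithinAt L (Set.Ici x) x) ∧
        Tendsto L atBot atTop ∧ Tendsto L atTop (nhds 0) := by
  have pos : ∀ x, 0 < 1 + L x := fun x => by linarith [hL x]
  have inv : (fun x => (1 / (1 + L x))⁻¹ - 1) = L := by
    funext x
    simp
  constructor
  · rintro ⟨hm, hc, hb, ht⟩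
    refine ⟨fun x y hxy => ?_, fun x => ?_, ?_, ?_⟩
    · have h := (one_div_le_one_div (pos x) (pos y)).1 (hm hxy)
      linarith
    · have h := ((hc x).inv₀ (one_div_pos.2 (pos x)).ne').sub
        (continuousWithinAt_const (b := (1 : ℝ)))
      rw [← inv]
      exact h
    · have h : Tendsto (fun x => 1 / (1 + L x)) atBot (nhdsWithin 0 (Set.Ioi 0)) :=
        tendsto_nhdsWithin_iff.2 ⟨hb, Eventually.of_forall fun x => one_div_pos.2 (pos x)⟩
      rw [← inv]
      exact tendsto_atTop_add_const_right _ (-1) h.inv_tendsto_nhdsGT_zero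
    · have h := (ht.inv₀ one_ne_zero).sub_const 1
      rw [← inv]
      simpa using h
  · rintro ⟨hm, hc, hb, ht⟩
    refine ⟨fun x y hxy => ?_, fun x => ?_, ?_, ?_⟩
    · exact one_div_le_one_div_of_le (pos y) (by linarith [hm hxy])
    · exact continuousWithinAt_const.div (continuousWithinAt_const.add (hc x)) (pos x).ne'
    · simp only [one_div]
      exact (tendsto_atTop_add_const_left _ 1 hb).inv_tendsto_atTop
    · simpa using (ht.const_add 1).inv₀ (by norm_num)

theorem isDistributionFunction_exp_neg_iff (L : ℝ → ℝ) :
    IsDistributionFunction (fun x => Real.exp (-L x)) ↔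
      Antitone L ∧ (∀ x : ℝ, ContinuousWithinAt L (Set.Ici x) x) ∧
        Tendsto L atBot atTop ∧ Tendsto L atTop (nhds 0) := by
  have inv : (fun x => -Real.log (Real.exp (-L x))) = L := by
    funext x
    simp
  constructor
  · rintro ⟨hm, hc, hb, ht⟩
    refine ⟨fun x y hxy => ?_, fun x => ?_, ?_, ?_⟩
    · exact neg_le_neg_iff.1 (Real.exp_le_exp.1 (hm hxy))
    · have h := ((hc x).log (Real.exp_pos _).ne').neg
      rw [← inv]
      exact h
    · exact tendsto_neg_atBot_iff.1 (Real.tendsto_exp_comp_nhds_zero.1 hb)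
    · have h := (ht.log one_ne_zero).neg
      rw [← inv]
      simpa using h
  · rintro ⟨hm, hc, hb, ht⟩
    refine ⟨fun x y hxy => ?_, fun x => ?_, ?_, ?_⟩
    · exact Real.exp_le_exp.2 (neg_le_neg (hm hxy))
    · exact (hc x).neg.rexp
    · exact Real.tendsto_exp_comp_nhds_zero.2 (tendsto_neg_atBot_iff.2 hb)
    · simpa using ht.neg.rexp

/-- Theorem 2.2: the G-gamma-MID(β) function is a d.f. iff the gamma-MID(β)
function is a d.f. -/
theorem g_gamma_mid_df_iff_gamma_mid_df (ψ : ℝ → ℝ) (hψ : ∀ x, 0 ≤ ψ x) (β : ℝ) (hβ : 0 < β) :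
    IsDistributionFunction (fun x => 1 / (1 + β * Real.log (1 + ψ x))) ↔
    IsDistributionFunction (fun x => (1 + ψ x) ^ (-β)) := by
  have rpow_eq : (fun x => (1 + ψ x) ^ (-β)) =
      fun x => Real.exp (-(β * Real.log (1 + ψ x))) := by
    funext x
    rw [Real.rpow_def_of_pos (by linarith [hψ x])]
    congr 1
    ring
  rw [rpow_eq, isDistributionFunction_exp_neg_iff (fun x => β * Real.log (1 + ψ x))]
  exact isDistributionFunction_one_div_one_add_iff (fun x => β * Real.log (1 + ψ x))
    fun x => mul_nonneg hβ.le (Real.log_nonneg (by linarith [hψ x]))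
end

section
/- If F : ℝ → ℝ is a distribution function with F(x) > 0 for every x ∈ ℝ, then the function G(x) = 1/(1 − log F(x)) is again a distribution function satisfying G(x) > 0 for every x (so the operation F ↦ 1/(1 − log F) can be iterated to obtain new distribution functions) (Remark 2.1). -/
open Filter

/-- Remark 2.1: if `F` is a d.f. with `F > 0`, then `G = 1/(1 - log F)` is again
a d.f. with `G > 0`, so the operation can be iterated. -/
theorem one_div_one_sub_log_df (F : ℝ → ℝ) (hF : IsDistributionFunction F)
    (hFpos : ∀ x, 0 < F x) :
    IsDistributionFunction (fun x => 1 / (1 - Real.log (F x))) ∧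
    (∀ x, 0 < 1 / (1 - Real.log (F x))) := by
  have hle : ∀ x, F x ≤ 1 := fun x => hF.1.ge_of_tendsto hF.2.2.2 x
  obtain ⟨hmono, hcont, hbot, htop⟩ := hF
  have hden : ∀ x, 0 < 1 - Real.log (F x) := fun x => by
    linarith [Real.log_nonpos (hFpos x).le (hle x)]
  refine ⟨⟨fun x y hxy => ?_, fun x => ?_, ?_, ?_⟩, fun x => one_div_pos.2 (hden x)⟩
  · exact one_div_le_one_div_of_le (hden y)
      (sub_le_sub_left (Real.log_le_log (hFpos x) (hmono hxy)) 1)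
  · exact continuousWithinAt_const.div
      (continuousWithinAt_const.sub ((hcont x).log (hFpos x).ne')) (hden x).ne'
  · have hlog : Tendsto (fun x => Real.log (F x)) atBot atBot :=
      Real.tendsto_log_nhdsGT_zero.comp
        (tendsto_nhdsWithin_iff.2 ⟨hbot, Eventually.of_forall hFpos⟩)
    have hsub : Tendsto (fun x => 1 - Real.log (F x)) atBot atTop := by
      simpa only [sub_eq_add_neg, Function.comp_apply] using
        tendsto_atTop_add_const_left _ 1 (tendsto_neg_atBot_atTop.comp hlog)
    exact hsub.const_div_atTop 1
  · have hlog := htop.log one_ne_zero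
    simpa using (hlog.const_sub 1).inv₀ (by simp)
end

section
/- Let ψ : ℝ → ℝ be nonnegative and β > 0. For each integer n ≥ 1 define F_n(x) = ((1/n)·(1+ψ(x))^(−β/n)) / (1 − ((n−1)/n)·(1+ψ(x))^(−β/n)), the d.f. of a geometric(1/n)-maximum of i.i.d. gamma-MID(β/n) variables. Then for every x ∈ ℝ, F_n(x) converges as n → ∞ to 1/(1 + β·log(1 + ψ(x))), the G-gamma-MID(β) function (Theorem 2.3). -/
open Filter

theorem tendsto_natCast_mul_exp_div_sub_one (c : ℝ) :
    Tendsto (fun n : ℕ => (n : ℝ) * (Real.exp (c / n) - 1)) atTop (nhds c) := by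
  have hderiv : HasDerivAt (fun t : ℝ => Real.exp (c * t)) c 0 := by
    simpa using ((hasDerivAt_id (0 : ℝ)).const_mul c).exp
  have hinv : Tendsto (fun n : ℕ => (n : ℝ)⁻¹) atTop (nhdsWithin 0 (Set.Ioi 0)) :=
    tendsto_inv_atTop_nhdsGT_zero.comp tendsto_natCast_atTop_atTop
  refine (hderiv.tendsto_slope_zero_right.comp hinv).congr fun n => ?_
  simp [div_eq_mul_inv]

/-- Theorem 2.3: the d.f. of a geometric(1/n)-maximum of i.i.d. gamma-MID(β/n)
variables converges pointwise, as n → ∞, to the G-gamma-MID(β) function. -/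
theorem geometric_max_gamma_mid_tendsto_g_gamma_mid
    (ψ : ℝ → ℝ) (hψ : ∀ x, 0 ≤ ψ x) (β : ℝ) (hβ : 0 < β) (x : ℝ) :
    Tendsto
      (fun n : ℕ =>
        ((1 / (n : ℝ)) * (1 + ψ x) ^ (-(β / (n : ℝ)))) /
          (1 - (((n : ℝ) - 1) / (n : ℝ)) * (1 + ψ x) ^ (-(β / (n : ℝ)))))
      atTop (nhds (1 / (1 + β * Real.log (1 + ψ x)))) := by
  have hx := hψ x
  have hlog : 0 ≤ Real.log (1 + ψ x) := Real.log_nonneg (by linarith)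
  have hne : 1 + β * Real.log (1 + ψ x) ≠ 0 := by positivity
  refine (tendsto_const_nhds.div ((tendsto_natCast_mul_exp_div_sub_one
    (β * Real.log (1 + ψ x))).const_add 1) hne).congr' ?_
  filter_upwards [eventually_gt_atTop 0] with n hn
  have hn' : (n : ℝ) ≠ 0 := by positivity
  have hpow : (1 + ψ x) ^ (-(β / (n : ℝ))) =
      (Real.exp (β * Real.log (1 + ψ x) / n))⁻¹ := by
    rw [Real.rpow_def_of_pos (by linarith), ← Real.exp_neg]
    congr 1
    ring
  rw [Pi.div_apply, hpow]
  have hexp := Real.exp_ne_zero (β * Real.log (1 + ψ x) / n)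
  generalize Real.exp (β * Real.log (1 + ψ x) / n) = q at hexp
  have hden : 1 - ((n : ℝ) - 1) / n * q⁻¹ = (1 + n * (q - 1)) * (1 / n * q⁻¹) := by
    field_simp
    ring
  rw [hden, div_mul_cancel_right₀ (by positivity), one_div]
end

section
/- For every β > 0, the function f(λ) = 1/(1 + β·log(1+λ)) is completely monotone on (0,∞): for every natural number n and every λ > 0, (−1)^n · f^(n)(λ) ≥ 0, where f^(n) denotes the n-th derivative. (This is the fact that 1/(1 + β·log(1+λ)) = 1/(1 + log(1+λ)^β) is the Laplace transform of the geometric gamma(β) law, used in Theorem 3.2; for β = 1 it is the Laplace transform of Pillai's geometric exponential law.) -/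
open Polynomial in
/-- A real polynomial with nonnegative coefficients is nonnegative at nonnegative points. -/
theorem Polynomial.eval_nonneg_of_coeff_nonneg {p : ℝ[X]} (hp : ∀ k, 0 ≤ p.coeff k) {y : ℝ}
    (hy : 0 ≤ y) : 0 ≤ p.eval y := by
  rw [Polynomial.eval_eq_sum_range]
  exact Finset.sum_nonneg fun k _ => mul_nonneg (hp k) (pow_nonneg hy k)

theorem one_add_mul_log_one_add_pos {β : ℝ} (hβ : 0 < β) {x : ℝ} (hx : 0 < x) :
    0 < 1 + β * Real.log (1 + x) := by
  have := Real.log_pos (by linarith : 1 < 1 + x)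
  positivity

theorem hasDerivAt_one_div_one_add_mul_log {β : ℝ} (hβ : 0 < β) {x : ℝ} (hx : 0 < x) :
    HasDerivAt (fun t : ℝ => 1 / (1 + β * Real.log (1 + t)))
      (-(β * (1 + x)⁻¹ * (1 / (1 + β * Real.log (1 + x))) ^ 2)) x := by
  have hpos := one_add_mul_log_one_add_pos hβ hx
  have hlog : HasDerivAt (fun t : ℝ => 1 + β * Real.log (1 + t)) (β * (1 / (1 + x))) x :=
    ((((hasDerivAt_id' x).const_add 1).log (by linarith)).const_mul β).const_add 1
  simp only [one_div] at hlog ⊢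
  refine (hlog.fun_inv hpos.ne').congr_deriv ?_
  rw [inv_pow, div_eq_mul_inv]
  ring

open Polynomial in
/-- The `n`-th derivative of `f(x) = 1/(1 + β·log(1+x))` is `(−1)^n (1+x)^(-n) p(f(x))` for a
polynomial `p` with nonnegative coefficients. -/
theorem exists_iteratedDeriv_one_div_one_add_mul_log_eq {β : ℝ} (hβ : 0 < β) (n : ℕ) :
    ∃ p : ℝ[X], (∀ k, 0 ≤ p.coeff k) ∧ ∀ x : ℝ, 0 < x →
      iteratedDeriv n (fun t : ℝ => 1 / (1 + β * Real.log (1 + t))) x =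
        (-1) ^ n * ((1 + x)⁻¹ ^ n * p.eval (1 / (1 + β * Real.log (1 + x)))) := by
  induction n with
  | zero =>
    refine ⟨X, fun k => ?_, fun x _ => by simp⟩
    rw [coeff_X]
    split_ifs <;> norm_num
  | succ n ih =>
    obtain ⟨p, hp, hderiv⟩ := ih
    refine ⟨C (n : ℝ) * p + C β * (derivative p * X ^ 2), fun k => ?_, fun x hx => ?_⟩
    · rw [coeff_add, coeff_C_mul, coeff_C_mul, coeff_mul_X_pow']
      refine add_nonneg (mul_nonneg n.cast_nonneg (hp k)) (mul_nonneg hβ.le ?_)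
      split_ifs
      · rw [coeff_derivative]
        exact mul_nonneg (hp _) (by positivity)
      · exact le_rfl
    · have hev : iteratedDeriv n (fun t : ℝ => 1 / (1 + β * Real.log (1 + t))) =ᶠ[nhds x]
          fun t => (-1) ^ n * ((1 + t)⁻¹ ^ n * p.eval (1 / (1 + β * Real.log (1 + t)))) := by
        filter_upwards [Ioi_mem_nhds hx] with t ht using hderiv t ht
      have hx1 : 1 + x ≠ 0 := by linarith
      have hpow := (((hasDerivAt_id' x).const_add 1).fun_inv hx1).fun_pow n
      have heval := (p.hasDerivAt _).comp x (hasDerivAt_one_div_one_add_mul_log hβ hx)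
      rw [iteratedDeriv_succ, hev.deriv_eq]
      refine ((hpow.fun_mul heval).const_mul ((-1 : ℝ) ^ n)).deriv.trans ?_
      simp only [Function.comp_apply, eval_add, eval_mul, eval_C, eval_pow, eval_X]
      generalize 1 / (1 + β * Real.log (1 + x)) = y
      rcases n with _ | n
      · simp
        ring
      · rw [Nat.add_sub_cancel, neg_div, one_div, ← inv_pow]
        ring


/-- The Laplace transform `λ ↦ 1/(1 + β·log(1+λ))` of the geometric gamma(β)
law is completely monotone on `(0,∞)`: it is infinitely differentiable there
and `(−1)^n · f^(n)(λ) ≥ 0` for every `n` and every `λ > 0`. -/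
theorem g_gamma_laplace_transform_completely_monotone (β : ℝ) (hβ : 0 < β) :
    ContDiffOn ℝ (⊤ : ℕ∞) (fun fl : ℝ => 1 / (1 + β * Real.log (1 + fl))) (Set.Ioi 0) ∧
    ∀ (n : ℕ) (fl : ℝ), 0 < fl →
      0 ≤ (-1 : ℝ) ^ n *
        iteratedDeriv n (fun fl : ℝ => 1 / (1 + β * Real.log (1 + fl))) fl := by
  refine ⟨fun x hx => ContDiffAt.contDiffWithinAt ?_, fun n x hx => ?_⟩
  · have hx1 : 1 + x ≠ 0 := by linarith [Set.mem_Ioi.mp hx]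
    have hlog : ContDiffAt ℝ (⊤ : ℕ∞) (fun t : ℝ => Real.log (1 + t)) x :=
      (contDiffAt_const.add contDiffAt_id).log hx1
    exact contDiffAt_const.div (contDiffAt_const.add (contDiffAt_const.mul hlog))
      (one_add_mul_log_one_add_pos hβ hx).ne'
  · obtain ⟨p, hp, hderiv⟩ := exists_iteratedDeriv_one_div_one_add_mul_log_eq hβ n
    rw [hderiv x hx, ← mul_assoc, ← mul_pow, neg_one_mul, neg_neg, one_pow, one_mul]
    have hpos := one_add_mul_log_one_add_pos hβ hx
    exact mul_nonneg (by positivity)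
      (Polynomial.eval_nonneg_of_coeff_nonneg hp (one_div_pos.mpr hpos).le)
end

section
/- Let ψ : ℝ → ℝ be nonnegative, β > 0, p ∈ (0,1), and let F, F_ε : ℝ → ℝ with 0 < F_ε(x) ≤ 1 for all x satisfy the max-AR(1) stationarity relation F(x) = p·F_ε(x)/(1 − (1−p)·F_ε(x)) for all x. Then F(x) = 1/(1 + (β/p)·log(1+ψ(x))) for all x (the stationary sequence is G-gamma-MID(β/p)) if and only if F_ε(x) = 1/(1 + β·log(1+ψ(x))) for all x (the innovations are G-gamma-MID(β)) (Theorems 3.3 and 3.4: the max-AR(1) process is stationary Markovian with a G-gamma-MID marginal if and only if the innovations are G-gamma-MID with parameter multiplied by p). -/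
/-- Theorems 3.3 and 3.4: in the max-AR(1) scheme the stationary marginal is
G-gamma-MID(β/p) iff the innovations are G-gamma-MID(β). -/
theorem max_ar1_g_gamma_mid_iff
    (ψ : ℝ → ℝ) (hψ : ∀ x, 0 ≤ ψ x) (β : ℝ) (hβ : 0 < β)
    (p : ℝ) (hp : p ∈ Set.Ioo (0 : ℝ) 1) (F Fε : ℝ → ℝ)
    (hFε : ∀ x, Fε x ∈ Set.Ioc (0 : ℝ) 1)
    (hstat : ∀ x, F x = p * Fε x / (1 - (1 - p) * Fε x)) :
    (∀ x : ℝ, F x = 1 / (1 + (β / p) * Real.log (1 + ψ x))) ↔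
    (∀ x : ℝ, Fε x = 1 / (1 + β * Real.log (1 + ψ x))) := by
  obtain ⟨hp0, hp1⟩ := hp
  refine forall_congr' fun x => ?_
  obtain ⟨he0, he1⟩ := hFε x
  have hL : 0 ≤ β * Real.log (1 + ψ x) :=
    mul_nonneg hβ.le (Real.log_nonneg (by linarith [hψ x]))
  have hD : 1 - (1 - p) * Fε x ≠ 0 := by nlinarith
  have hA : 1 + β * Real.log (1 + ψ x) ≠ 0 := by linarith
  have hB : 1 + β / p * Real.log (1 + ψ x) ≠ 0 := by
    rw [div_mul_eq_mul_div]
    positivity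
  have key : p * Fε x * (1 + β / p * Real.log (1 + ψ x)) =
      Fε x * (p + β * Real.log (1 + ψ x)) := by
    field_simp
  rw [hstat, div_eq_div_iff hD hB, eq_div_iff hA, key]
  constructor <;> intro h <;> linarith
end
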